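/- arXiv:2005.06706 — 6 statements merged into one kernel-verified Lean document; each statement's English description precedes it below -/
import Mathlib

section
/- Let (M_k) be a sequence of n×n real matrices, M∞ a fixed n×n matrix, ξ ≥ 1 and t_mix a positive integer, satisfying: (i) ‖∏_{k=a}^{b} M_k‖ ≤ ξ for all a ≤ b and ‖M∞‖ ≤ ξ; (ii) M_k M∞ = M∞ and M∞ M_k = M∞ for all k; (iii) for every index s and every n×d matrix X, ‖(∏_{k=s}^{s+t_mix−1} M_k) X − M∞ X‖ ≤ (1/2)‖X − M∞ X‖. Then for all s ≤ t and every n×d matrix X, ‖(∏_{k=s}^{t−1} M_k) X − M∞ X‖ ≤ 2^{−⌊(t−s)/t_mix⌋} (1+ξ) ξ ‖X‖. -/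
attribute [local instance] Matrix.frobeniusNormedAddCommGroup

section OrderedProduct

variable {n d : ℕ} {M : ℕ → Matrix (Fin n) (Fin n) ℝ} {P : ℕ → ℕ → Matrix (Fin n) (Fin n) ℝ}

/-- Ordered products over adjacent intervals compose. -/
theorem ordered_product_mul (hPdiag : ∀ s, P s s = 1)
    (hPsucc : ∀ s t, s ≤ t → P s (t + 1) = M t * P s t) (s u k : ℕ) (hsu : s ≤ u) :
    P s (u + k) = P u (u + k) * P s u := by
  induction k with
  | zero => simp [hPdiag]
  | succ k ih =>
    rw [← Nat.add_assoc, hPsucc s (u + k) (by omega), hPsucc u (u + k) (by omega), ih,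
      Matrix.mul_assoc]

/-- A matrix absorbing every factor on its right absorbs every ordered product. -/
theorem mul_ordered_product {A : Matrix (Fin n) (Fin n) ℝ} (hPdiag : ∀ s, P s s = 1)
    (hPsucc : ∀ s t, s ≤ t → P s (t + 1) = M t * P s t) (hA : ∀ k, A * M k = A) (s k : ℕ) :
    A * P s (s + k) = A := by
  induction k with
  | zero => simp [hPdiag]
  | succ k ih =>
    rw [← Nat.add_assoc, hPsucc s (s + k) (by omega), ← Matrix.mul_assoc, hA, ih]

/-- Iterating the one-block contraction over `q` consecutive blocks of length `T`. -/
theorem norm_ordered_product_blocks_le {A : Matrix (Fin n) (Fin n) ℝ} {T : ℕ}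
    (hPdiag : ∀ s, P s s = 1)
    (hPsucc : ∀ s t, s ≤ t → P s (t + 1) = M t * P s t) (hA : ∀ k, A * M k = A)
    (hmix : ∀ s (X : Matrix (Fin n) (Fin d) ℝ),
      ‖P s (s + T) * X - A * X‖ ≤ (1 / 2) * ‖X - A * X‖)
    (s q : ℕ) (X : Matrix (Fin n) (Fin d) ℝ) :
    ‖P s (s + q * T) * X - A * X‖ ≤ (1 / 2 : ℝ) ^ q * ‖X - A * X‖ := by
  induction q with
  | zero => simp [hPdiag]
  | succ q ih =>
    have h := hmix (s + q * T) (P s (s + q * T) * X)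
    rw [← Matrix.mul_assoc, ← Matrix.mul_assoc,
      ← ordered_product_mul hPdiag hPsucc s (s + q * T) T (by omega),
      mul_ordered_product hPdiag hPsucc hA] at h
    rw [Nat.succ_mul, ← Nat.add_assoc, pow_succ']
    linarith

end OrderedProduct

/-- **Lemma 1.** Under the scale-bound assumption (`‖∏_{k=a}^{b} M_k‖ ≤ ξ` for all
`a ≤ b` and `‖M∞‖ ≤ ξ`), the consensus assumption (`M_k M∞ = M∞ M_k = M∞`), and the mixing-time
assumption (`‖(∏_{k=s}^{s+t_mix−1} M_k)X − M∞X‖ ≤ ½‖X − M∞X‖`), for all `s ≤ t` and every `n×d`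
matrix `X`, `‖(∏_{k=s}^{t−1} M_k)X − M∞X‖ ≤ 2^{−⌊(t−s)/t_mix⌋}(1+ξ)ξ‖X‖`.  Here `P s t` denotes
the ordered product `M_{t−1} ⋯ M_s` (with `P s s = 1`), and `‖·‖` is the Frobenius norm. -/
theorem mixing_matrix_product_contraction
    (n d : ℕ) (M : ℕ → Matrix (Fin n) (Fin n) ℝ) (Minf : Matrix (Fin n) (Fin n) ℝ)
    (ξ : ℝ) (tmix : ℕ) (hξ : 1 ≤ ξ) (htmix : 0 < tmix)
    (P : ℕ → ℕ → Matrix (Fin n) (Fin n) ℝ)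
    (hPdiag : ∀ s, P s s = 1)
    (hPsucc : ∀ s t, s ≤ t → P s (t + 1) = M t * P s t)
    (hscale : ∀ a b, a ≤ b → ‖P a (b + 1)‖ ≤ ξ)
    (hscaleinf : ‖Minf‖ ≤ ξ)
    (hconsensus : ∀ k, M k * Minf = Minf ∧ Minf * M k = Minf)
    (hmix : ∀ s (X : Matrix (Fin n) (Fin d) ℝ),
      ‖P s (s + tmix) * X - Minf * X‖ ≤ (1 / 2) * ‖X - Minf * X‖) :
    ∀ s t, s ≤ t → ∀ X : Matrix (Fin n) (Fin d) ℝ,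
      ‖P s t * X - Minf * X‖ ≤ (1 / 2 : ℝ) ^ ((t - s) / tmix) * (1 + ξ) * ξ * ‖X‖ := by
  intro s t hst X
  have hA : ∀ k, Minf * M k = Minf := fun k => (hconsensus k).2
  set q := (t - s) / tmix
  set r := (t - s) % tmix
  have ht : t = s + r + q * tmix := by
    have : r + q * tmix = t - s := Nat.mod_add_div' (t - s) tmix
    omega
  have hblocks :=
    norm_ordered_product_blocks_le hPdiag hPsucc hA hmix (s + r) q (P s (s + r) * X)
  rw [← Matrix.mul_assoc, ← Matrix.mul_assoc,
    ← ordered_product_mul hPdiag hPsucc s (s + r) (q * tmix) (by omega),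
    mul_ordered_product hPdiag hPsucc hA, ← ht] at hblocks
  have hX : 0 ≤ ‖X‖ := norm_nonneg X
  have hinf : ‖Minf * X‖ ≤ ξ * ‖X‖ :=
    (Matrix.frobenius_norm_mul Minf X).trans (mul_le_mul_of_nonneg_right hscaleinf hX)
  have hrem : ‖P s (s + r) * X‖ ≤ ξ * ‖X‖ := by
    rcases Nat.eq_zero_or_pos r with hr | hr
    · rw [hr, Nat.add_zero, hPdiag, Matrix.one_mul]
      exact le_mul_of_one_le_left hX hξ
    · have hP := hscale s (s + r - 1) (by omega)
      rw [Nat.sub_add_cancel (by omega)] at hP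
      exact (Matrix.frobenius_norm_mul _ X).trans (mul_le_mul_of_nonneg_right hP hX)
  have hbound : ‖P s (s + r) * X - Minf * X‖ ≤ (1 + ξ) * ξ * ‖X‖ := by
    have htri := norm_sub_le (P s (s + r) * X) (Minf * X)
    have hξX : 0 ≤ ξ * ‖X‖ := by positivity
    nlinarith
  calc ‖P s t * X - Minf * X‖
      ≤ (1 / 2 : ℝ) ^ q * ‖P s (s + r) * X - Minf * X‖ := hblocks
    _ ≤ (1 / 2 : ℝ) ^ q * ((1 + ξ) * ξ * ‖X‖) := by gcongr
    _ = (1 / 2 : ℝ) ^ q * (1 + ξ) * ξ * ‖X‖ := by ring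
end

section
/- Let f : ℝ^d → ℝ be differentiable with L-Lipschitz gradient. Let (x_t) and (u_t) be random sequences adapted to a filtration (F_t) with x_{t+1} = x_t − α_t(∇f(u_t) − ζ_t), where the noise ζ_t satisfies E[ζ_t | F_t] = 0 and E[‖ζ_t‖² | F_t] ≤ σ², and the deterministic step sizes satisfy 0 < α_t and α_t L ≤ 1. Then ∑_{t=0}^{T−1} α_t E‖∇f(x_t)‖² ≤ 2(E f(x_0) − E f(x_T)) + L σ² ∑_{t=0}^{T−1} α_t² + ∑_{t=0}^{T−1} α_t E‖∇f(x_t) − ∇f(u_t)‖². -/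
open MeasureTheory

/-- The quadratic upper bound for a function with `L`-Lipschitz gradient. -/
theorem apply_add_le_of_lipschitz_gradient {E : Type*} [NormedAddCommGroup E]
    [InnerProductSpace ℝ E] [CompleteSpace E] {f : E → ℝ} {L : ℝ} (hdiff : Differentiable ℝ f)
    (hlip : ∀ x y, ‖gradient f x - gradient f y‖ ≤ L * ‖x - y‖) (x v : E) :
    f (x + v) ≤ f x + inner ℝ (gradient f x) v + L / 2 * ‖v‖ ^ 2 := by
  have hderiv (s : ℝ) :
      HasDerivAt (fun s : ℝ => f (x + s • v)) (inner ℝ (gradient f (x + s • v)) v) s := by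
    have hline : HasDerivAt (fun s : ℝ => x + s • v) v s := by
      simpa using ((hasDerivAt_id s).smul_const v).const_add x
    have hgrad := (hdiff (x + s • v)).hasGradientAt.hasFDerivAt.comp_hasDerivAt s hline
    simpa [Function.comp_def] using hgrad
  have hbound (s : ℝ) : HasDerivAt
      (fun s : ℝ => f x + s * inner ℝ (gradient f x) v + L / 2 * ‖v‖ ^ 2 * s ^ 2)
      (inner ℝ (gradient f x) v + L * ‖v‖ ^ 2 * s) s := by
    have h := (((hasDerivAt_id s).mul_const (inner ℝ (gradient f x) v)).const_add (f x)).add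
      (((hasDerivAt_id s).pow 2).const_mul (L / 2 * ‖v‖ ^ 2))
    refine h.congr_deriv ?_
    simp only [id]
    push_cast
    ring
  have key := image_le_of_deriv_right_le_deriv_boundary (a := 0) (b := 1)
    (fun s _ => (hderiv s).continuousAt.continuousWithinAt)
    (fun s _ => (hderiv s).hasDerivWithinAt) (by simp)
    (fun s _ => (hbound s).continuousAt.continuousWithinAt)
    (fun s _ => (hbound s).hasDerivWithinAt)
    (fun s hs => by
      have hinner := real_inner_le_norm (gradient f (x + s • v) - gradient f x) v
      have hnorm := hlip (x + s • v) x
      rw [add_sub_cancel_left, norm_smul, Real.norm_of_nonneg hs.1] at hnorm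
      have hmul := mul_le_mul_of_nonneg_right hnorm (norm_nonneg v)
      rw [inner_sub_left] at hinner
      linarith)
    (Set.right_mem_Icc.2 zero_le_one)
  simpa using key

/-- One gradient step along an inexact gradient `g` with additive noise `z`. -/
theorem gradient_step_descent {E : Type*} [NormedAddCommGroup E]
    [InnerProductSpace ℝ E] [CompleteSpace E] {f : E → ℝ} {L a : ℝ} (hdiff : Differentiable ℝ f)
    (hlip : ∀ x y, ‖gradient f x - gradient f y‖ ≤ L * ‖x - y‖) (ha : 0 ≤ a) (haL : a * L ≤ 1)
    (x g z : E) :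
    2 * f (x - a • (g - z)) ≤ 2 * f x - a * ‖gradient f x‖ ^ 2 + a * ‖gradient f x - g‖ ^ 2
      + L * a ^ 2 * ‖z‖ ^ 2 + 2 * inner ℝ (a • gradient f x - (L * a ^ 2) • g) z := by
  have h := apply_add_le_of_lipschitz_gradient hdiff hlip x (-(a • (g - z)))
  rw [← sub_eq_add_neg, norm_neg, norm_smul, Real.norm_of_nonneg ha, mul_pow,
    norm_sub_sq_real, inner_neg_right, inner_smul_right, inner_sub_right] at h
  rw [norm_sub_sq_real, inner_sub_left, real_inner_smul_left, real_inner_smul_left]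
  have hstep : a * (a * L) * ‖g‖ ^ 2 ≤ a * 1 * ‖g‖ ^ 2 := by gcongr
  linarith

section Probability

variable {Ω E : Type*} {m m0 : MeasurableSpace Ω} {μ : Measure Ω} [NormedAddCommGroup E]
  [InnerProductSpace ℝ E]

theorem MeasureTheory.MemLp.integrable_real_inner {v z : Ω → E} (hv : MemLp v 2 μ)
    (hz : MemLp z 2 μ) : Integrable (fun ω => inner ℝ (v ω) (z ω)) μ := by
  have hv2 := (memLp_two_iff_integrable_sq_norm hv.1).1 hv
  have hz2 := (memLp_two_iff_integrable_sq_norm hz.1).1 hz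
  refine (hv2.add hz2).mono' (hv.1.inner hz.1) (ae_of_all _ fun ω => ?_)
  have h := norm_inner_le_norm (𝕜 := ℝ) (v ω) (z ω)
  simp only [Pi.add_apply]
  nlinarith [sq_nonneg (‖v ω‖ - ‖z ω‖), sq_nonneg (‖v ω‖ + ‖z ω‖)]

/-- A conditionally centred random vector is orthogonal to every `m`-measurable one. -/
theorem integral_inner_eq_zero_of_condExp_eq_zero [CompleteSpace E] [IsFiniteMeasure μ]
    (hm : m ≤ m0) {v z : Ω → E} (hvm : StronglyMeasurable[m] v)
    (hv : MemLp v 2 μ) (hz : MemLp z 2 μ) (hmean : μ[z | m] =ᵐ[μ] 0) :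
    ∫ ω, inner ℝ (v ω) (z ω) ∂μ = 0 := by
  have hpull := condExp_bilin_of_stronglyMeasurable_left (innerSL ℝ) hvm
    (hv.integrable_real_inner hz) (hz.integrable one_le_two)
  rw [← integral_condExp hm]
  refine integral_eq_zero_of_ae ?_
  filter_upwards [hpull, hmean] with ω h h0
  exact h.trans (by simp [h0])

theorem integral_le_of_condExp_le [IsProbabilityMeasure μ] (hm : m ≤ m0) {X : Ω → ℝ} {c : ℝ}
    (h : ∀ᵐ ω ∂μ, (μ[X | m]) ω ≤ c) : ∫ ω, X ω ∂μ ≤ c := by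
  rw [← integral_condExp hm]
  simpa using integral_mono_ae integrable_condExp (integrable_const c) h

/-- The expected decrease of `f` in one stochastic gradient step. -/
theorem integral_gradient_step_descent [CompleteSpace E] [IsProbabilityMeasure μ] (hm : m ≤ m0)
    {f : E → ℝ} {L a σ : ℝ} (hL : 0 ≤ L) (hdiff : Differentiable ℝ f)
    (hlip : ∀ x y, ‖gradient f x - gradient f y‖ ≤ L * ‖x - y‖) (ha : 0 ≤ a) (haL : a * L ≤ 1)
    {x u z : Ω → E} (hx : StronglyMeasurable[m] x) (hu : StronglyMeasurable[m] u)
    (hzint : Integrable z μ) (hmean : μ[z | m] =ᵐ[μ] 0)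
    (hzsq : Integrable (fun ω => ‖z ω‖ ^ 2) μ)
    (hvar : ∀ᵐ ω ∂μ, (μ[fun ω' => ‖z ω'‖ ^ 2 | m]) ω ≤ σ ^ 2)
    (hfx : Integrable (fun ω => f (x ω)) μ)
    (hfstep : Integrable (fun ω => f (x ω - a • (gradient f (u ω) - z ω))) μ)
    (hgrad : Integrable (fun ω => ‖gradient f (x ω)‖ ^ 2) μ)
    (hdev : Integrable (fun ω => ‖gradient f (x ω) - gradient f (u ω)‖ ^ 2) μ) :
    a * ∫ ω, ‖gradient f (x ω)‖ ^ 2 ∂μ ≤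
      2 * ((∫ ω, f (x ω) ∂μ) - ∫ ω, f (x ω - a • (gradient f (u ω) - z ω)) ∂μ)
        + L * σ ^ 2 * a ^ 2 + a * ∫ ω, ‖gradient f (x ω) - gradient f (u ω)‖ ^ 2 ∂μ := by
  have hcont : Continuous (gradient f) :=
    (LipschitzWith.of_dist_le_mul (K := L.toNNReal) fun y y' => by
      simpa [dist_eq_norm, Real.coe_toNNReal L hL] using hlip y y').continuous
  have hgx := hcont.comp_stronglyMeasurable hx
  have hgu := hcont.comp_stronglyMeasurable hu
  have hgx2 : MemLp (fun ω => gradient f (x ω)) 2 μ :=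
    (memLp_two_iff_integrable_sq_norm (hgx.mono hm).aestronglyMeasurable).2 hgrad
  have hdev2 : MemLp (fun ω => gradient f (x ω) - gradient f (u ω)) 2 μ :=
    (memLp_two_iff_integrable_sq_norm ((hgx.sub hgu).mono hm).aestronglyMeasurable).2 hdev
  have hgu2 : MemLp (fun ω => gradient f (u ω)) 2 μ := by
    simpa [Pi.sub_def] using hgx2.sub hdev2
  have hz2 : MemLp z 2 μ := (memLp_two_iff_integrable_sq_norm hzint.1).2 hzsq
  have hv2 : MemLp (fun ω => a • gradient f (x ω) - (L * a ^ 2) • gradient f (u ω)) 2 μ :=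
    (hgx2.const_smul a).sub (hgu2.const_smul (L * a ^ 2))
  have hvm : StronglyMeasurable[m]
      (fun ω => a • gradient f (x ω) - (L * a ^ 2) • gradient f (u ω)) :=
    (hgx.const_smul a).sub (hgu.const_smul (L * a ^ 2))
  have hinner := hv2.integrable_real_inner hz2
  have hmono := integral_mono (hfstep.const_mul 2)
    (((((hfx.const_mul 2).sub (hgrad.const_mul a)).add (hdev.const_mul a)).add
      (hzsq.const_mul (L * a ^ 2))).add (hinner.const_mul 2))
    (fun ω => gradient_step_descent hdiff hlip ha haL (x ω) (gradient f (u ω)) (z ω))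
  rw [integral_add' ((((hfx.const_mul 2).sub (hgrad.const_mul a)).add (hdev.const_mul a)).add
      (hzsq.const_mul (L * a ^ 2))) (hinner.const_mul 2),
    integral_add' (((hfx.const_mul 2).sub (hgrad.const_mul a)).add (hdev.const_mul a))
      (hzsq.const_mul (L * a ^ 2)),
    integral_add' ((hfx.const_mul 2).sub (hgrad.const_mul a)) (hdev.const_mul a),
    integral_sub' (hfx.const_mul 2) (hgrad.const_mul a)] at hmono
  simp only [integral_const_mul] at hmono
  rw [integral_inner_eq_zero_of_condExp_eq_zero hm hvm hv2 hz2 hmean] at hmono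
  have hnoise := mul_le_mul_of_nonneg_left (integral_le_of_condExp_le hm hvar)
    (mul_nonneg hL (sq_nonneg a))
  linarith

end Probability

/-- **Lemma 3.** For `f : ℝ^d → ℝ` differentiable with `L`-Lipschitz gradient,
iterates `x_{t+1} = x_t − αₜ(∇f(uₜ) − ζₜ)` adapted to a filtration `(Fₜ)`, noise `ζₜ` which is
`F_{t+1}`-measurable, conditionally zero-mean with conditional second moment at most `σ²`, and
deterministic step sizes `0 < αₜ`, `αₜ L ≤ 1`:
`∑_{t<T} αₜ E‖∇f(xₜ)‖² ≤ 2(E f(x₀) − E f(x_T)) + Lσ² ∑_{t<T} αₜ² + ∑_{t<T} αₜ E‖∇f(xₜ) − ∇f(uₜ)‖²`. -/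
theorem sgd_descent_telescoped {d : ℕ}
    {Ω : Type*} {m0 : MeasurableSpace Ω} (μ : Measure Ω) [IsProbabilityMeasure μ]
    (ℱ : Filtration ℕ m0)
    (f : EuclideanSpace ℝ (Fin d) → ℝ) (L : ℝ) (hL : 0 < L)
    (hdiff : Differentiable ℝ f)
    (hlip : ∀ x y, ‖gradient f x - gradient f y‖ ≤ L * ‖x - y‖)
    (x u ζ : ℕ → Ω → EuclideanSpace ℝ (Fin d))
    (α : ℕ → ℝ) (σ : ℝ)
    (hα : ∀ t, 0 < α t) (hαL : ∀ t, α t * L ≤ 1)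
    (hxad : ∀ t, StronglyMeasurable[ℱ t] (x t))
    (huad : ∀ t, StronglyMeasurable[ℱ t] (u t))
    (hζad : ∀ t, StronglyMeasurable[ℱ (t + 1)] (ζ t))
    (hrec : ∀ t, x (t + 1) = fun ω => x t ω - α t • (gradient f (u t ω) - ζ t ω))
    (hζint : ∀ t, Integrable (ζ t) μ)
    (hζmean : ∀ t, μ[ζ t | ℱ t] =ᵐ[μ] 0)
    (hζsqint : ∀ t, Integrable (fun ω => ‖ζ t ω‖ ^ 2) μ)
    (hζvar : ∀ t, ∀ᵐ ω ∂μ, (μ[fun ω' => ‖ζ t ω'‖ ^ 2 | ℱ t]) ω ≤ σ ^ 2)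
    (hfint : ∀ t, Integrable (fun ω => f (x t ω)) μ)
    (hgradsq : ∀ t, Integrable (fun ω => ‖gradient f (x t ω)‖ ^ 2) μ)
    (hdiffsq : ∀ t, Integrable (fun ω => ‖gradient f (x t ω) - gradient f (u t ω)‖ ^ 2) μ)
    (T : ℕ) :
    ∑ t ∈ Finset.range T, α t * ∫ ω, ‖gradient f (x t ω)‖ ^ 2 ∂μ
      ≤ 2 * ((∫ ω, f (x 0 ω) ∂μ) - ∫ ω, f (x T ω) ∂μ)
        + L * σ ^ 2 * ∑ t ∈ Finset.range T, (α t) ^ 2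
        + ∑ t ∈ Finset.range T, α t * ∫ ω, ‖gradient f (x t ω) - gradient f (u t ω)‖ ^ 2 ∂μ := by
  induction T with
  | zero => simp
  | succ t ih =>
    have hstep := integral_gradient_step_descent (ℱ.le t) hL.le hdiff hlip (hα t).le (hαL t)
      (hxad t) (huad t) (hζint t) (hζmean t) (hζsqint t) (hζvar t) (hfint t)
      (by simpa only [hrec t] using hfint (t + 1)) (hgradsq t) (hdiffsq t)
    have hnext : ∫ ω, f (x (t + 1) ω) ∂μ =
        ∫ ω, f (x t ω - α t • (gradient f (u t ω) - ζ t ω)) ∂μ := by rw [hrec t]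
    rw [Finset.sum_range_succ, Finset.sum_range_succ, Finset.sum_range_succ, hnext]
    linarith
end

section
/- Fix 0 ≤ β₁ < 1, 0 ≤ β₂ < 1, p > 0, c > 0, G∞ > 0, L > 0. For a sequence of points z_0,…,z_t in ℝ^d and gradient maps g_k : ℝ^d → ℝ^d, define the Adam-type update δ_t(z_t,…,z_0) ∈ ℝ^d coordinatewise by δ_{t,j} = ((1−β₁) ∑_{k=0}^{t} β₁^{t−k} g_k(z_k)_j) / ((1−β₂) ∑_{k=0}^{t} β₂^{t−k} g_k(z_k)_j²)^p. Suppose each g_k is L-Lipschitz, all gradient entries along the relevant interpolating sequences are bounded so that the numerator satisfies |m_{t,j}| ≤ G∞ and |g_{k,j} · m_{t,j}| ≤ G∞, and the denominator base v_{t,j} = (1−β₂)∑_{k} β₂^{t−k} g_{k,j}² is bounded below by c throughout. Let M = min{c^p/2, c^{p+1}/(4 p G∞)}. Then for any two sequences (u_k) and (x_k) in ℝ^d: ‖δ_t(u_t,…,u_0) − δ_t(x_t,…,x_0)‖² ≤ ∑_{k=0}^{t} ((1−β₁) β₁^{t−k}/(M c^p) + 2 p (1−β₂) β₂^{t−k}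 G∞/(M c^{p+1})) L² ‖u_k − x_k‖², and moreover ∑_{k=0}^{∞} ((1−β₁) β₁^{k}/(M c^p) + 2 p (1−β₂) β₂^{k} G∞/(M c^{p+1})) L² = ((c + 2 p G∞)/(M c^{p+1})) L². -/
/-- Lipschitz estimate for `(∑ w k γ k) / (∑ q k (γ k)²)^p` along the segment from `b` to `a`. -/
theorem abs_sub_div_rpow_le {ι : Type*} (s : Finset ι) (w q a b : ι → ℝ) {p c G : ℝ}
    (hw : ∀ k ∈ s, 0 ≤ w k) (hq : ∀ k ∈ s, 0 ≤ q k) (hp : 0 < p) (hc : 0 < c)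
    (hprod : ∀ r ∈ Set.Icc (0 : ℝ) 1, ∀ k ∈ s,
      |(b k + r * (a k - b k)) * ∑ i ∈ s, w i * (b i + r * (a i - b i))| ≤ G)
    (hv : ∀ r ∈ Set.Icc (0 : ℝ) 1, c ≤ ∑ i ∈ s, q i * (b i + r * (a i - b i)) ^ 2) :
    |(∑ k ∈ s, w k * a k) / (∑ k ∈ s, q k * a k ^ 2) ^ p
        - (∑ k ∈ s, w k * b k) / (∑ k ∈ s, q k * b k ^ 2) ^ p|
      ≤ ∑ k ∈ s, (w k / c ^ p + 2 * p * q k * G / c ^ (p + 1)) * |a k - b k| := by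
  set m : ℝ → ℝ := fun r => ∑ i ∈ s, w i * (b i + r * (a i - b i)) with hm
  set v : ℝ → ℝ := fun r => ∑ i ∈ s, q i * (b i + r * (a i - b i)) ^ 2 with hvdef
  have hγ (k : ι) (r : ℝ) : HasDerivAt (fun r => b k + r * (a k - b k)) (a k - b k) r := by
    simpa using ((hasDerivAt_id r).mul_const (a k - b k)).const_add (b k)
  have hm' (r : ℝ) : HasDerivAt m (∑ i ∈ s, w i * (a i - b i)) r :=
    HasDerivAt.fun_sum fun k _ => (hγ k r).const_mul (w k)
  have hv' (r : ℝ) : HasDerivAt v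
      (∑ i ∈ s, q i * (2 * (b i + r * (a i - b i)) * (a i - b i))) r := by
    refine HasDerivAt.fun_sum fun k _ => ?_
    simpa using ((hγ k r).pow 2).const_mul (q k)
  have hF (r : ℝ) (hr : r ∈ Set.Icc (0 : ℝ) 1) : HasDerivAt (fun r => m r * v r ^ (-p))
      (∑ i ∈ s, (w i / v r ^ p - 2 * p * q i * ((b i + r * (a i - b i)) * m r) / v r ^ (p + 1))
        * (a i - b i)) r := by
    have hpos : 0 < v r := hc.trans_le (hv r hr)
    refine ((hm' r).mul ((hv' r).rpow_const (p := -p) (Or.inl hpos.ne'))).congr_deriv ?_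
    generalize m r = μ
    rw [show -p - 1 = -(p + 1) by ring, Real.rpow_neg hpos.le, Real.rpow_neg hpos.le,
      Finset.sum_mul, Finset.sum_mul, Finset.sum_mul, Finset.mul_sum, ← Finset.sum_add_distrib]
    refine Finset.sum_congr rfl fun k _ => ?_
    simp only [div_eq_mul_inv]
    ring
  have hbd (r : ℝ) (hr : r ∈ Set.Icc (0 : ℝ) 1) :
      ‖∑ i ∈ s, (w i / v r ^ p - 2 * p * q i * ((b i + r * (a i - b i)) * m r) / v r ^ (p + 1))
        * (a i - b i)‖
      ≤ ∑ k ∈ s, (w k / c ^ p + 2 * p * q k * G / c ^ (p + 1)) * |a k - b k| := by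
    refine (norm_sum_le _ _).trans (Finset.sum_le_sum fun k hk => ?_)
    rw [norm_mul, Real.norm_eq_abs, Real.norm_eq_abs]
    refine mul_le_mul_of_nonneg_right ((abs_sub _ _).trans ?_) (abs_nonneg _)
    have hcv := hv r hr
    have hG := hprod r hr k hk
    have hG0 : 0 ≤ G := (abs_nonneg _).trans hG
    have hpos : 0 < v r := hc.trans_le hcv
    have hwk := hw k hk
    have hqk := hq k hk
    rw [abs_div, abs_div, abs_of_nonneg hwk, abs_of_pos (Real.rpow_pos_of_pos hpos _),
      abs_of_pos (Real.rpow_pos_of_pos hpos _), abs_mul (2 * p * q k),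
      abs_of_nonneg (show 0 ≤ 2 * p * q k by positivity)]
    gcongr
  have key := norm_image_sub_le_of_norm_deriv_le_segment_01'
    (fun r hr => (hF r hr).hasDerivWithinAt) (fun r hr => hbd r ⟨hr.1, hr.2.le⟩)
  have h0 : 0 ≤ v 0 := hc.le.trans (hv 0 (by simp))
  have h1 : 0 ≤ v 1 := hc.le.trans (hv 1 (by simp))
  simp only [Real.rpow_neg h0, Real.rpow_neg h1, ← div_eq_mul_inv, Real.norm_eq_abs] at key
  simpa [hm, hvdef] using key

theorem one_sub_mul_sum_pow_sub_le_one {β : ℝ} (h0 : 0 ≤ β) (t : ℕ) :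
    ∑ k ∈ Finset.range (t + 1), (1 - β) * β ^ (t - k) ≤ 1 := by
  rw [← Finset.mul_sum, Finset.sum_flip (fun k => β ^ k), mul_neg_geom_sum]
  linarith [pow_nonneg h0 (t + 1)]

/-- Weighted Cauchy–Schwarz for weights of total mass at most `B`. -/
theorem sq_sum_mul_le {ι : Type*} (s : Finset ι) (C y : ι → ℝ) {B : ℝ}
    (hC : ∀ k ∈ s, 0 ≤ C k) (hB : ∑ k ∈ s, C k ≤ B) :
    (∑ k ∈ s, C k * y k) ^ 2 ≤ B * ∑ k ∈ s, C k * y k ^ 2 := by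
  refine (Finset.sum_sq_le_sum_mul_sum_of_sq_le_mul s hC
    (fun k hk => mul_nonneg (hC k hk) (sq_nonneg (y k))) fun k _ => le_of_eq (by ring)).trans ?_
  exact mul_le_mul_of_nonneg_right hB
    (Finset.sum_nonneg fun k hk => mul_nonneg (hC k hk) (sq_nonneg _))

/-- **Lemma 4.** For the Adam-type update
`δ_t(z_t,…,z_0)_j = ((1−β₁)∑_{k≤t} β₁^{t−k} g_k(z_k)_j) / ((1−β₂)∑_{k≤t} β₂^{t−k} g_k(z_k)_j²)^p`,
with each `g_k` being `L`-Lipschitz, and with the numerator `m`, the products `γ·m`, and the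
denominator base `v` bounded (by `G∞`, `G∞`, and below by `c` respectively) along all relevant
interpolating gradient values (any choice `γ k` in the segment between `g_k(u_k)_j` and
`g_k(x_k)_j`), and `M = min{c^p/2, c^{p+1}/(4pG∞)}`:  for any two sequences `(u_k)`, `(x_k)`,
`‖δ_t(u) − δ_t(x)‖² ≤ ∑_{k≤t} ((1−β₁)β₁^{t−k}/(Mc^p) + 2p(1−β₂)β₂^{t−k}G∞/(Mc^{p+1})) L² ‖u_k−x_k‖²`,
and `∑_{k=0}^{∞} ((1−β₁)β₁^k/(Mc^p) + 2p(1−β₂)β₂^k G∞/(Mc^{p+1})) L² = ((c+2pG∞)/(Mc^{p+1})) L²`. -/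
theorem adam_update_lipschitz_chain {d : ℕ}
    (β₁ β₂ p c Ginf L : ℝ)
    (hβ₁0 : 0 ≤ β₁) (hβ₁1 : β₁ < 1) (hβ₂0 : 0 ≤ β₂) (hβ₂1 : β₂ < 1)
    (hp : 0 < p) (hc : 0 < c) (hG : 0 < Ginf) (hL : 0 < L)
    (g : ℕ → EuclideanSpace ℝ (Fin d) → EuclideanSpace ℝ (Fin d))
    (hg : ∀ k x y, ‖g k x - g k y‖ ≤ L * ‖x - y‖)
    (u x : ℕ → EuclideanSpace ℝ (Fin d))
    (δ : ℕ → (ℕ → EuclideanSpace ℝ (Fin d)) → EuclideanSpace ℝ (Fin d))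
    (hδ : ∀ t z (j : Fin d), δ t z j =
      ((1 - β₁) * ∑ k ∈ Finset.range (t + 1), β₁ ^ (t - k) * g k (z k) j) /
        ((1 - β₂) * ∑ k ∈ Finset.range (t + 1), β₂ ^ (t - k) * (g k (z k) j) ^ 2) ^ p)
    (M : ℝ) (hM : M = min (c ^ p / 2) (c ^ (p + 1) / (4 * p * Ginf)))
    (hbound : ∀ t (j : Fin d) (γ : ℕ → ℝ),
      (∀ k, γ k ∈ segment ℝ (g k (u k) j) (g k (x k) j)) →
        (|(1 - β₁) * ∑ k ∈ Finset.range (t + 1), β₁ ^ (t - k) * γ k| ≤ Ginf ∧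
         (∀ k ≤ t, |γ k * ((1 - β₁) * ∑ i ∈ Finset.range (t + 1), β₁ ^ (t - i) * γ i)| ≤ Ginf) ∧
         c ≤ (1 - β₂) * ∑ k ∈ Finset.range (t + 1), β₂ ^ (t - k) * (γ k) ^ 2)) :
    (∀ t, ‖δ t u - δ t x‖ ^ 2 ≤
      ∑ k ∈ Finset.range (t + 1),
        ((1 - β₁) * β₁ ^ (t - k) / (M * c ^ p)
          + 2 * p * (1 - β₂) * β₂ ^ (t - k) * Ginf / (M * c ^ (p + 1))) * L ^ 2
          * ‖u k - x k‖ ^ 2) ∧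
    ∑' k : ℕ, ((1 - β₁) * β₁ ^ k / (M * c ^ p)
        + 2 * p * (1 - β₂) * β₂ ^ k * Ginf / (M * c ^ (p + 1))) * L ^ 2
      = ((c + 2 * p * Ginf) / (M * c ^ (p + 1))) * L ^ 2 := by
  have hcp : 0 < c ^ p := Real.rpow_pos_of_pos hc p
  have hcp1 : 0 < c ^ (p + 1) := Real.rpow_pos_of_pos hc (p + 1)
  have hM0 : 0 < M := by
    rw [hM]
    exact lt_min (by positivity) (by positivity)
  have hM1 : 1 / c ^ p ≤ 1 / (2 * M) := by
    refine one_div_le_one_div_of_le (by positivity) ?_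
    linarith [hM.trans_le (min_le_left _ _)]
  have hM2 : 2 * p * Ginf / c ^ (p + 1) ≤ 1 / (2 * M) := by
    have h : M ≤ c ^ (p + 1) / (4 * p * Ginf) := hM.trans_le (min_le_right _ _)
    rw [le_div_iff₀ (by positivity)] at h
    rw [div_le_div_iff₀ hcp1 (by positivity)]
    linarith
  have h1β₁ : 0 ≤ 1 - β₁ := by linarith
  have h1β₂ : 0 ≤ 1 - β₂ := by linarith
  refine ⟨fun t => ?_, ?_⟩
  · set C : ℕ → ℝ := fun k => (1 - β₁) * β₁ ^ (t - k) / c ^ p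
      + 2 * p * ((1 - β₂) * β₂ ^ (t - k)) * Ginf / c ^ (p + 1) with hCdef
    have hC (k : ℕ) : 0 ≤ C k := by positivity
    have hCsum : ∑ k ∈ Finset.range (t + 1), C k ≤ 1 / M := by
      have hsplit : ∑ k ∈ Finset.range (t + 1), C k
          = (∑ k ∈ Finset.range (t + 1), (1 - β₁) * β₁ ^ (t - k)) * (1 / c ^ p)
            + (∑ k ∈ Finset.range (t + 1), (1 - β₂) * β₂ ^ (t - k))
              * (2 * p * Ginf / c ^ (p + 1)) := by
        rw [Finset.sum_mul, Finset.sum_mul, ← Finset.sum_add_distrib]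
        refine Finset.sum_congr rfl fun k _ => ?_
        simp only [hCdef]
        ring
      have hb₁ := mul_le_of_le_one_left (show 0 ≤ 1 / c ^ p by positivity)
        (one_sub_mul_sum_pow_sub_le_one hβ₁0 t)
      have hb₂ := mul_le_of_le_one_left (show 0 ≤ 2 * p * Ginf / c ^ (p + 1) by positivity)
        (one_sub_mul_sum_pow_sub_le_one hβ₂0 t)
      have hhalf : 1 / M = 1 / (2 * M) + 1 / (2 * M) := by
        field_simp
        norm_num
      rw [hsplit, hhalf]
      linarith
    have hcoord (j : Fin d) : (δ t u j - δ t x j) ^ 2 ≤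
        1 / M * ∑ k ∈ Finset.range (t + 1), C k * (g k (u k) j - g k (x k) j) ^ 2 := by
      have hseg (r : ℝ) (hr : r ∈ Set.Icc (0 : ℝ) 1) := hbound t j
        (fun k => g k (x k) j + r * (g k (u k) j - g k (x k) j)) fun k =>
          ⟨r, 1 - r, hr.1, by linarith [hr.2], by ring, by simp only [smul_eq_mul]; ring⟩
      have hlip := abs_sub_div_rpow_le (Finset.range (t + 1))
        (fun k => (1 - β₁) * β₁ ^ (t - k)) (fun k => (1 - β₂) * β₂ ^ (t - k))
        (fun k => g k (u k) j) (fun k => g k (x k) j) (G := Ginf)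
        (fun k _ => by positivity) (fun k _ => by positivity) hp hc
        (fun r hr k hk => by
          simpa only [Finset.mul_sum, mul_assoc] using
            (hseg r hr).2.1 k (Nat.lt_succ_iff.mp (Finset.mem_range.mp hk)))
        (fun r hr => by simpa only [Finset.mul_sum, mul_assoc] using (hseg r hr).2.2)
      have hdiff : |δ t u j - δ t x j| ≤
          ∑ k ∈ Finset.range (t + 1), C k * |g k (u k) j - g k (x k) j| := by
        simpa only [hδ, Finset.mul_sum, mul_assoc, hCdef] using hlip
      rw [← sq_abs]
      refine (pow_le_pow_left₀ (abs_nonneg _) hdiff 2).trans ?_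
      simpa only [sq_abs] using sq_sum_mul_le _ C (fun k => |g k (u k) j - g k (x k) j|)
        (fun k _ => hC k) hCsum
    have hgsq (k : ℕ) :
        ∑ j, (g k (u k) j - g k (x k) j) ^ 2 ≤ L ^ 2 * ‖u k - x k‖ ^ 2 := by
      have h := pow_le_pow_left₀ (norm_nonneg _) (hg k (u k) (x k)) 2
      rwa [EuclideanSpace.real_norm_sq_eq, mul_pow] at h
    calc ‖δ t u - δ t x‖ ^ 2 = ∑ j, (δ t u j - δ t x j) ^ 2 := by
          rw [EuclideanSpace.real_norm_sq_eq]; rfl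
      _ ≤ ∑ j, 1 / M * ∑ k ∈ Finset.range (t + 1), C k * (g k (u k) j - g k (x k) j) ^ 2 :=
          Finset.sum_le_sum fun j _ => hcoord j
      _ = ∑ k ∈ Finset.range (t + 1),
            1 / M * C k * ∑ j, (g k (u k) j - g k (x k) j) ^ 2 := by
          simp only [Finset.mul_sum, mul_assoc]
          exact Finset.sum_comm
      _ ≤ ∑ k ∈ Finset.range (t + 1), 1 / M * C k * (L ^ 2 * ‖u k - x k‖ ^ 2) :=
          Finset.sum_le_sum fun k _ => mul_le_mul_of_nonneg_left (hgsq k)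
            (mul_nonneg (by positivity) (hC k))
      _ = _ := by
          refine Finset.sum_congr rfl fun k _ => ?_
          simp only [hCdef]
          field_simp
  · have hs₁ := (hasSum_geometric_of_lt_one hβ₁0 hβ₁1).mul_left ((1 - β₁) / (M * c ^ p))
    have hs₂ := (hasSum_geometric_of_lt_one hβ₂0 hβ₂1).mul_left
      (2 * p * (1 - β₂) * Ginf / (M * c ^ (p + 1)))
    have hs := ((hs₁.add hs₂).mul_right (L ^ 2)).tsum_eq
    have hne₁ : 1 - β₁ ≠ 0 := by linarith
    have hne₂ : 1 - β₂ ≠ 0 := by linarith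
    convert hs using 1
    · refine tsum_congr fun k => ?_
      ring
    · rw [Real.rpow_add_one hc.ne']
      field_simp
end

section
/- Fix 0 ≤ β₁ < 1, 0 ≤ β₂ < 1, p > 0, c > 0, G∞ > 0, integers 0 ≤ k ≤ t, and constants a, b ≥ 0. Define φ : ℝ → ℝ by φ(g) = m(g)/v(g)^p where m(g) = (1−β₁)(a + β₁^{t−k} g) and v(g) = (1−β₂)(b + β₂^{t−k} g²). Then at any point g where v(g) ≥ c, |m(g)| ≤ G∞, and |g · m(g)| ≤ G∞ hold, φ is differentiable and |φ'(g)| ≤ (1−β₁) β₁^{t−k}/c^p + 2 p (1−β₂) β₂^{t−k} G∞/c^{p+1}. -/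
theorem hasDerivAt_div_rpow {m v : ℝ → ℝ} {m' v' x : ℝ} (hm : HasDerivAt m m' x)
    (hv : HasDerivAt v v' x) (hx : 0 < v x) (p : ℝ) :
    HasDerivAt (fun y => m y / v y ^ p) (m' / v x ^ p - p * m x * v' / v x ^ (p + 1)) x := by
  have hp : v x ^ p ≠ 0 := (Real.rpow_pos_of_pos hx p).ne'
  have hx0 : v x ≠ 0 := hx.ne'
  refine (hm.fun_div (hv.rpow_const (p := p) (Or.inl hx0)) hp).congr_deriv ?_
  rw [Real.rpow_sub_one hx0, Real.rpow_add_one hx0]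
  field_simp

/-- For `φ(g) = m(g)/v(g)^p` with `m(g) = (1−β₁)(a + β₁^{t−k} g)` and
`v(g) = (1−β₂)(b + β₂^{t−k} g²)`, at any point `g` where `v(g) ≥ c`, `|m(g)| ≤ G∞` and
`|g·m(g)| ≤ G∞`, the function `φ` is differentiable and
`|φ'(g)| ≤ (1−β₁)β₁^{t−k}/c^p + 2p(1−β₂)β₂^{t−k}G∞/c^{p+1}`. -/
theorem adam_coordinate_derivative_bound
    (β₁ β₂ p c Ginf : ℝ) (t k : ℕ)
    (hβ₁0 : 0 ≤ β₁) (hβ₁1 : β₁ < 1) (hβ₂0 : 0 ≤ β₂) (hβ₂1 : β₂ < 1)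
    (hp : 0 < p) (hc : 0 < c) (hG : 0 < Ginf) (hkt : k ≤ t)
    (a b : ℝ) (ha : 0 ≤ a) (hb : 0 ≤ b)
    (m v φ : ℝ → ℝ)
    (hm : ∀ g, m g = (1 - β₁) * (a + β₁ ^ (t - k) * g))
    (hv : ∀ g, v g = (1 - β₂) * (b + β₂ ^ (t - k) * g ^ 2))
    (hφ : ∀ g, φ g = m g / (v g) ^ p) :
    ∀ g : ℝ, c ≤ v g → |m g| ≤ Ginf → |g * m g| ≤ Ginf →
      DifferentiableAt ℝ φ g ∧
      |deriv φ g| ≤ (1 - β₁) * β₁ ^ (t - k) / c ^ p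
        + 2 * p * (1 - β₂) * β₂ ^ (t - k) * Ginf / c ^ (p + 1) := by
  intro g hcv _ hgm
  have hv0 : 0 < v g := hc.trans_le hcv
  have hm' : HasDerivAt m ((1 - β₁) * β₁ ^ (t - k)) g := by
    rw [funext hm]
    simpa using (((hasDerivAt_id g).const_mul (β₁ ^ (t - k))).const_add a).const_mul (1 - β₁)
  have hv' : HasDerivAt v ((1 - β₂) * (β₂ ^ (t - k) * (2 * g))) g := by
    rw [funext hv]
    simpa using (((hasDerivAt_pow 2 g).const_mul (β₂ ^ (t - k))).const_add b).const_mul (1 - β₂)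
  have hφ' := hasDerivAt_div_rpow hm' hv' hv0 p
  rw [← funext hφ] at hφ'
  refine ⟨hφ'.differentiableAt, ?_⟩
  rw [hφ'.deriv]
  have hA : 0 ≤ (1 - β₁) * β₁ ^ (t - k) := mul_nonneg (by linarith) (by positivity)
  have hB : 0 ≤ 2 * p * (1 - β₂) * β₂ ^ (t - k) :=
    mul_nonneg (mul_nonneg (by positivity) (by linarith)) (by positivity)
  refine (abs_sub _ _).trans (add_le_add ?_ ?_)
  · rw [abs_of_nonneg (by positivity)]
    gcongr
  · have hnum : p * m g * ((1 - β₂) * (β₂ ^ (t - k) * (2 * g)))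
        = 2 * p * (1 - β₂) * β₂ ^ (t - k) * (g * m g) := by ring
    rw [hnum, abs_div, abs_mul, abs_of_nonneg hB,
      abs_of_pos (Real.rpow_pos_of_pos hv0 (p + 1))]
    gcongr
end

section
/- Let 0 ≤ ρ < 1, let T be a positive integer, and let (a_t)_{t≥1} and (b_t)_{t≥1} be nonnegative real sequences with (a_t) non-increasing. Then for every positive integer k: ∑_{t=1}^{k} a_t (∑_{s=1}^{t} ρ^{⌊(t−s)/T⌋} b_s) ≤ (T/(1−ρ)) ∑_{s=1}^{k} a_s b_s. -/
theorem sum_range_mul_pow_div (ρ : ℝ) {T : ℕ} (hT : 0 < T) (m : ℕ) :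
    ∑ i ∈ Finset.range (T * m), ρ ^ (i / T) = T * ∑ j ∈ Finset.range m, ρ ^ j := by
  induction m with
  | zero => simp
  | succ m ih =>
    have hblock : ∀ i ∈ Finset.range T, ρ ^ ((T * m + i) / T) = ρ ^ m := fun i hi => by
      rw [Nat.mul_add_div hT, Nat.div_eq_of_lt (Finset.mem_range.mp hi), add_zero]
    rw [Nat.mul_succ, Finset.sum_range_add, ih, Finset.sum_congr rfl hblock,
      Finset.sum_range_succ, Finset.sum_const, Finset.card_range, nsmul_eq_mul, mul_add]

theorem sum_range_pow_div_le {ρ : ℝ} {T : ℕ} (hρ0 : 0 ≤ ρ) (hρ1 : ρ < 1) (hT : 0 < T) (n : ℕ) :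
    ∑ i ∈ Finset.range n, ρ ^ (i / T) ≤ T / (1 - ρ) := by
  have hgeom : ∑ j ∈ Finset.range n, ρ ^ j ≤ 1 / (1 - ρ) := by
    rw [le_div_iff₀ (sub_pos.mpr hρ1), geom_sum_mul_neg]
    linarith [pow_nonneg hρ0 n]
  calc ∑ i ∈ Finset.range n, ρ ^ (i / T)
      ≤ ∑ i ∈ Finset.range (T * n), ρ ^ (i / T) :=
        Finset.sum_le_sum_of_subset_of_nonneg
          (Finset.range_mono (Nat.le_mul_of_pos_left n hT)) fun _ _ _ => pow_nonneg hρ0 _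
    _ = T * ∑ j ∈ Finset.range n, ρ ^ j := sum_range_mul_pow_div ρ hT n
    _ ≤ T * (1 / (1 - ρ)) := by gcongr
    _ = T / (1 - ρ) := by ring

theorem sum_Icc_pow_sub_div_le {ρ : ℝ} {T : ℕ} (hρ0 : 0 ≤ ρ) (hρ1 : ρ < 1) (hT : 0 < T)
    (s k : ℕ) : ∑ t ∈ Finset.Icc s k, ρ ^ ((t - s) / T) ≤ T / (1 - ρ) := by
  rw [← Finset.Ico_add_one_right_eq_Icc, Finset.sum_Ico_eq_sum_range]
  simpa using sum_range_pow_div_le hρ0 hρ1 hT (k + 1 - s)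

/-- Let `0 ≤ ρ < 1`, `T` a positive integer, and `(aₜ)`, `(bₜ)` nonnegative
sequences with `(aₜ)` non-increasing.  Then for every positive integer `k`,
`∑_{t=1}^{k} aₜ (∑_{s=1}^{t} ρ^{⌊(t−s)/T⌋} b_s) ≤ (T/(1−ρ)) ∑_{s=1}^{k} a_s b_s`. -/
theorem block_geometric_sum_bound
    (ρ : ℝ) (T : ℕ) (a b : ℕ → ℝ)
    (hρ0 : 0 ≤ ρ) (hρ1 : ρ < 1) (hT : 0 < T)
    (ha : ∀ t, 0 ≤ a t) (hb : ∀ t, 0 ≤ b t)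
    (hmono : ∀ s t, s ≤ t → a t ≤ a s) :
    ∀ k : ℕ, 0 < k →
      ∑ t ∈ Finset.Icc 1 k, a t * (∑ s ∈ Finset.Icc 1 t, ρ ^ ((t - s) / T) * b s)
        ≤ ((T : ℝ) / (1 - ρ)) * ∑ s ∈ Finset.Icc 1 k, a s * b s := by
  intro k _
  simp_rw [Finset.mul_sum]
  rw [Finset.sum_comm' (t' := Finset.Icc 1 k) (s' := fun s => Finset.Icc s k)
    (by intro t s; simp only [Finset.mem_Icc]; omega)]
  refine Finset.sum_le_sum fun s _ => ?_
  calc ∑ t ∈ Finset.Icc s k, a t * (ρ ^ ((t - s) / T) * b s)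
      ≤ ∑ t ∈ Finset.Icc s k, a s * (ρ ^ ((t - s) / T) * b s) :=
        Finset.sum_le_sum fun t ht => mul_le_mul_of_nonneg_right
          (hmono s t (Finset.mem_Icc.mp ht).1) (mul_nonneg (pow_nonneg hρ0 _) (hb s))
    _ = (∑ t ∈ Finset.Icc s k, ρ ^ ((t - s) / T)) * (a s * b s) := by
        rw [Finset.sum_mul]
        exact Finset.sum_congr rfl fun _ _ => by ring
    _ ≤ T / (1 - ρ) * (a s * b s) :=
        mul_le_mul_of_nonneg_right (sum_Icc_pow_sub_div_le hρ0 hρ1 hT s k)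
          (mul_nonneg (ha s) (hb s))
end

section
/- Let 0 ≤ ρ < 1, let T be a positive integer, and let (a_t)_{t≥1} and (b_t)_{t≥1} be nonnegative real sequences with (a_t) non-increasing. Then for every positive integer k: ∑_{t=1}^{k} a_t (∑_{s=1}^{t} ρ^{⌊(t−s)/T⌋} b_s)² ≤ (T²/(1−ρ)²) ∑_{s=1}^{k} a_s b_s². -/
/-- Block version of the finite geometric sum formula. -/
theorem sum_range_mul_pow_div_mul_one_sub (ρ : ℝ) {T : ℕ} (hT : 0 < T) (n : ℕ) :
    (∑ j ∈ Finset.range (n * T), ρ ^ (j / T)) * (1 - ρ) = T * (1 - ρ ^ n) := by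
  induction n with
  | zero => simp
  | succ n ih =>
    have h : ∀ j ∈ Finset.range T, ρ ^ ((n * T + j) / T) = ρ ^ n := fun j hj => by
      rw [Nat.mul_comm, Nat.mul_add_div hT, Nat.div_eq_of_lt (Finset.mem_range.1 hj), add_zero]
    rw [Nat.succ_mul, Finset.sum_range_add, add_mul, ih, Finset.sum_congr rfl h, Finset.sum_const,
      Finset.card_range, nsmul_eq_mul]
    ring

theorem sum_pow_div_le_of_injOn {ι : Type*} {ρ : ℝ} {T : ℕ} (hρ0 : 0 ≤ ρ) (hρ1 : ρ < 1)
    (hT : 0 < T) (S : Finset ι) (g : ι → ℕ) (hg : Set.InjOn g S) :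
    ∑ i ∈ S, ρ ^ (g i / T) ≤ T / (1 - ρ) := by
  rw [← Finset.sum_image (f := fun j => ρ ^ (j / T)) hg]
  set n := (S.image g).sup id + 1
  have hsub : S.image g ⊆ Finset.range (n * T) :=
    (Finset.subset_range_sup_succ _).trans
      (Finset.range_subset_range.2 (Nat.le_mul_of_pos_right n hT))
  refine (Finset.sum_le_sum_of_subset_of_nonneg hsub fun j _ _ => pow_nonneg hρ0 _).trans ?_
  rw [le_div_iff₀ (sub_pos.2 hρ1), sum_range_mul_pow_div_mul_one_sub ρ hT]
  exact mul_le_of_le_one_right T.cast_nonneg (sub_le_self _ (pow_nonneg hρ0 n))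

/-- Let `0 ≤ ρ < 1`, `T` a positive integer, and `(aₜ)`, `(bₜ)` nonnegative
sequences with `(aₜ)` non-increasing.  Then for every positive integer `k`,
`∑_{t=1}^{k} aₜ (∑_{s=1}^{t} ρ^{⌊(t−s)/T⌋} b_s)² ≤ (T²/(1−ρ)²) ∑_{s=1}^{k} a_s b_s²`. -/
theorem block_geometric_sum_sq_bound
    (ρ : ℝ) (T : ℕ) (a b : ℕ → ℝ)
    (hρ0 : 0 ≤ ρ) (hρ1 : ρ < 1) (hT : 0 < T)
    (ha : ∀ t, 0 ≤ a t) (hb : ∀ t, 0 ≤ b t)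
    (hmono : ∀ s t, s ≤ t → a t ≤ a s) :
    ∀ k : ℕ, 0 < k →
      ∑ t ∈ Finset.Icc 1 k, a t * (∑ s ∈ Finset.Icc 1 t, ρ ^ ((t - s) / T) * b s) ^ 2
        ≤ ((T : ℝ) ^ 2 / (1 - ρ) ^ 2) * ∑ s ∈ Finset.Icc 1 k, a s * b s ^ 2 := by
  intro k _
  have hw : ∀ n, 0 ≤ ρ ^ (n / T) := fun n => pow_nonneg hρ0 _
  have hW : 0 ≤ (T : ℝ) / (1 - ρ) := div_nonneg T.cast_nonneg (sub_pos.2 hρ1).le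
  have row : ∀ t, (∑ s ∈ Finset.Icc 1 t, ρ ^ ((t - s) / T) * b s) ^ 2
      ≤ T / (1 - ρ) * ∑ s ∈ Finset.Icc 1 t, ρ ^ ((t - s) / T) * b s ^ 2 := fun t => by
    refine (Finset.sum_sq_le_sum_mul_sum_of_sq_le_mul _ (fun s _ => hw (t - s))
      (fun s _ => mul_nonneg (hw (t - s)) (sq_nonneg (b s))) fun s _ => le_of_eq (by ring)).trans ?_
    refine mul_le_mul_of_nonneg_right (sum_pow_div_le_of_injOn hρ0 hρ1 hT _ (t - ·) ?_)
      (Finset.sum_nonneg fun s _ => mul_nonneg (hw _) (sq_nonneg _))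
    intro x hx y hy hxy
    simp only [Finset.coe_Icc, Set.mem_Icc] at hx hy hxy
    omega
  have col : ∀ s, ∑ t ∈ Finset.Icc s k, a t * ρ ^ ((t - s) / T) ≤ a s * (T / (1 - ρ)) :=
    fun s => calc
      _ ≤ ∑ t ∈ Finset.Icc s k, a s * ρ ^ ((t - s) / T) := Finset.sum_le_sum fun t ht =>
        mul_le_mul_of_nonneg_right (hmono s t (Finset.mem_Icc.1 ht).1) (hw _)
      _ ≤ a s * (T / (1 - ρ)) := by
        rw [← Finset.mul_sum]
        refine mul_le_mul_of_nonneg_left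
          (sum_pow_div_le_of_injOn hρ0 hρ1 hT _ (· - s) ?_) (ha s)
        intro x hx y hy hxy
        simp only [Finset.coe_Icc, Set.mem_Icc] at hx hy hxy
        omega
  calc
    _ ≤ ∑ t ∈ Finset.Icc 1 k,
          a t * (T / (1 - ρ) * ∑ s ∈ Finset.Icc 1 t, ρ ^ ((t - s) / T) * b s ^ 2) :=
      Finset.sum_le_sum fun t _ => mul_le_mul_of_nonneg_left (row t) (ha t)
    _ = T / (1 - ρ) * ∑ t ∈ Finset.Icc 1 k, ∑ s ∈ Finset.Icc 1 t,
          a t * ρ ^ ((t - s) / T) * b s ^ 2 := by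
      simp only [Finset.mul_sum]
      exact Finset.sum_congr rfl fun t _ => Finset.sum_congr rfl fun s _ => by ring
    _ = T / (1 - ρ) * ∑ s ∈ Finset.Icc 1 k,
          (∑ t ∈ Finset.Icc s k, a t * ρ ^ ((t - s) / T)) * b s ^ 2 := by
      simp only [Finset.sum_mul]
      congr 1
      refine Finset.sum_comm' fun t s => ?_
      simp only [Finset.mem_Icc]
      omega
    _ ≤ T / (1 - ρ) * ∑ s ∈ Finset.Icc 1 k, a s * (T / (1 - ρ)) * b s ^ 2 :=
      mul_le_mul_of_nonneg_left (Finset.sum_le_sum fun s _ =>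
        mul_le_mul_of_nonneg_right (col s) (sq_nonneg _)) hW
    _ = _ := by
      simp only [← div_pow, Finset.mul_sum]
      exact Finset.sum_congr rfl fun s _ => by ring
end
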